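/- For every n ≥ 2, the Mordell constant satisfies κ_n ≥ n^{-n/2}. -/

import Mathlib

open scoped BigOperators
open Matrix Topology Filter

noncomputable section

namespace SW

/-! ### Euclidean structure on `Fin n → ℝ` -/

/-- The standard Euclidean inner product on `Fin n → ℝ`. -/
def einner {n : ℕ} (v w : Fin n → ℝ) : ℝ := ∑ i, v i * w i

/-- The Euclidean norm on `Fin n → ℝ`. -/
def enorm {n : ℕ} (v : Fin n → ℝ) : ℝ := Real.sqrt (∑ i, v i ^ 2)

lemma einner_add_left {n : ℕ} (u v w : Fin n → ℝ) :
    einner (u + v) w = einner u w + einner v w := by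
  simp [einner, add_mul, Finset.sum_add_distrib]

lemma einner_neg_left {n : ℕ} (u w : Fin n → ℝ) : einner (-u) w = -einner u w := by
  simp [einner]

lemma einner_smul_left {n : ℕ} (c : ℝ) (u w : Fin n → ℝ) :
    einner (c • u) w = c * einner u w := by
  simp [einner, Finset.mul_sum, mul_assoc]

/-! ### Covolume, rank, lattices, stability -/

/-- `√(det Gram)` of a finite family of vectors: the covolume of the ℤ-span of the family
(in the span of the family) when the family is linearly independent. -/
def gvol {n r : ℕ} (v : Fin r → (Fin n → ℝ)) : ℝ :=
  Real.sqrt (Matrix.det (Matrix.of fun i j => einner (v i) (v j)))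

/-- `c` is the covolume of `Λ` in its real span, as computed from some ℤ-basis of `Λ` which is
linearly independent over `ℝ`. -/
def covolSpec {n : ℕ} (Λ : AddSubgroup (Fin n → ℝ)) (c : ℝ) : Prop :=
  ∃ (r : ℕ) (v : Fin r → (Fin n → ℝ)), LinearIndependent ℝ v ∧
    Λ = AddSubgroup.closure (Set.range v) ∧ c = gvol v

/-- The covolume of a discrete subgroup `Λ ⊆ ℝⁿ` inside its real span (with `covol ⊥ = 1`). -/
def covol {n : ℕ} (Λ : AddSubgroup (Fin n → ℝ)) : ℝ := sInf {c | covolSpec Λ c}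

/-- The rank of a discrete subgroup of `ℝⁿ`: the dimension of its real span. -/
def rk {n : ℕ} (Λ : AddSubgroup (Fin n → ℝ)) : ℕ :=
  Module.finrank ℝ (Submodule.span ℝ (Λ : Set (Fin n → ℝ)))

/-- A lattice in `ℝⁿ`: a discrete subgroup spanning `ℝⁿ` (equivalently, cocompact). -/
def IsLattice {n : ℕ} (L : AddSubgroup (Fin n → ℝ)) : Prop :=
  DiscreteTopology ↥L ∧ Submodule.span ℝ (L : Set (Fin n → ℝ)) = ⊤

/-- A unimodular lattice: a lattice of covolume one. -/
def IsUnimodularLattice {n : ℕ} (L : AddSubgroup (Fin n → ℝ)) : Prop :=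
  IsLattice L ∧ covol L = 1

/-- A stable lattice: a unimodular lattice all of whose subgroups have covolume at least one. -/
def IsStable {n : ℕ} (L : AddSubgroup (Fin n → ℝ)) : Prop :=
  IsUnimodularLattice L ∧ ∀ Λ : AddSubgroup (Fin n → ℝ), Λ ≤ L → 1 ≤ covol Λ

/-! ### Matrices: the diagonal group `A`, `SL_n(ℤ)`, lattices from matrices -/

/-- The group `A` of positive diagonal matrices of determinant one (as a set of matrices). -/
def Apos (n : ℕ) : Set (Matrix (Fin n) (Fin n) ℝ) :=
  {a | ∃ d : Fin n → ℝ, (∀ i, 0 < d i) ∧ (∏ i, d i) = 1 ∧ a = Matrix.diagonal d}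

/-- `SL_n(ℤ)` viewed as a set of real matrices. -/
def Gam (n : ℕ) : Set (Matrix (Fin n) (Fin n) ℝ) :=
  {γ | γ.det = 1 ∧ ∀ i j, ∃ m : ℤ, γ i j = (m : ℝ)}

/-- The lattice `g·ℤⁿ` associated to a matrix `g`. -/
def latticeOf {n : ℕ} (g : Matrix (Fin n) (Fin n) ℝ) : AddSubgroup (Fin n → ℝ) :=
  AddSubgroup.closure (Set.range fun m : Fin n → ℤ => g.mulVec fun i => (m i : ℝ))

/-- The image `g·L` of a lattice under a matrix. -/
def mapLat {n : ℕ} (g : Matrix (Fin n) (Fin n) ℝ) (L : AddSubgroup (Fin n → ℝ)) :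
    AddSubgroup (Fin n → ℝ) :=
  AddSubgroup.map (Matrix.mulVecLin g).toAddMonoidHom L

/-- The full preimage `A·g·Γ` in `SL_n(ℝ)` of the orbit `A·[g] ⊆ ℒ_n`; a point `[h] ∈ ℒ_n`
lies in the closure of `A·[g]` iff `h ∈ closure (AOrbit g)`. -/
def AOrbit {n : ℕ} (g : Matrix (Fin n) (Fin n) ℝ) : Set (Matrix (Fin n) (Fin n) ℝ) :=
  {p | ∃ a ∈ Apos n, ∃ γ ∈ Gam n, p = a * g * γ}

/-- The orbit `A·[g] ⊆ ℒ_n` is bounded (has compact closure). -/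
def HasBoundedAOrbit {n : ℕ} (g : Matrix (Fin n) (Fin n) ℝ) : Prop :=
  ∃ K : Set (Matrix (Fin n) (Fin n) ℝ), IsCompact K ∧
    ∀ a ∈ Apos n, ∃ γ ∈ Gam n, a * g * γ ∈ K

/-! ### `α`, `Min_δ`, `V_δ`, `dim_δ` -/

/-- `α(x) = min { |Λ|^{1/r(Λ)} : Λ a nonzero subgroup of x }`. -/
def alpha {n : ℕ} (x : AddSubgroup (Fin n → ℝ)) : ℝ :=
  sInf {c | ∃ Λ : AddSubgroup (Fin n → ℝ), Λ ≤ x ∧ Λ ≠ ⊥ ∧ c = covol Λ ^ ((rk Λ : ℝ)⁻¹)}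

/-- `α_k(x) = min { |Λ|^{1/k} : Λ a rank-`k` subgroup of x }`. -/
def alphak {n : ℕ} (k : ℕ) (x : AddSubgroup (Fin n → ℝ)) : ℝ :=
  sInf {c | ∃ Λ : AddSubgroup (Fin n → ℝ), Λ ≤ x ∧ rk Λ = k ∧ c = covol Λ ^ ((k : ℝ)⁻¹)}

/-- `Min_δ(x)`: nonzero subgroups nearly attaining `α(x)`. -/
def MinSet {n : ℕ} (δ : ℝ) (x : AddSubgroup (Fin n → ℝ)) : Set (AddSubgroup (Fin n → ℝ)) :=
  {Λ | Λ ≤ x ∧ Λ ≠ ⊥ ∧ covol Λ ^ ((rk Λ : ℝ)⁻¹) < (1 + δ) * alpha x}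

/-- `V_δ(x)`: the span of the subgroups in `Min_δ(x)`. -/
def Vdelta {n : ℕ} (δ : ℝ) (x : AddSubgroup (Fin n → ℝ)) : Submodule ℝ (Fin n → ℝ) :=
  Submodule.span ℝ (⋃ Λ ∈ MinSet δ x, (Λ : Set (Fin n → ℝ)))

/-- `dim_δ(x) = dim V_δ(x)`. -/
def dimdelta {n : ℕ} (δ : ℝ) (x : AddSubgroup (Fin n → ℝ)) : ℕ :=
  Module.finrank ℝ (Vdelta δ x)

/-- `U_k^{x,ε} ⊆ A`: those `a` for which `δ ↦ dim_δ(ax)` equals `k` near `kε`. -/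
def Uset {n : ℕ} (x : AddSubgroup (Fin n → ℝ)) (ε : ℝ) (k : ℕ) :
    Set (Matrix (Fin n) (Fin n) ℝ) :=
  {a | a ∈ Apos n ∧ ∃ s ∈ 𝓝 ((k : ℝ) * ε), ∀ δ ∈ s, dimdelta δ (mapLat a x) = k}

/-- Logarithmic coordinates on the diagonal group. -/
def logCoord {n : ℕ} (a : Matrix (Fin n) (Fin n) ℝ) : Fin n → ℝ := fun i => Real.log (a i i)

/-! ### Covering radius -/

/-- The covering radius `covrad(L) = sup_u inf_{v ∈ L} ‖u - v‖`. -/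
def covrad {n : ℕ} (L : AddSubgroup (Fin n → ℝ)) : ℝ :=
  ⨆ u : Fin n → ℝ, ⨅ v : L, enorm (u - (v : Fin n → ℝ))

/-- `[g]` is a local maximum of `covrad : ℒ_d → ℝ` (phrased via the open quotient
`SL_d(ℝ) → ℒ_d`). -/
def IsLocalMaxCovrad {d : ℕ} (g : Matrix (Fin d) (Fin d) ℝ) : Prop :=
  ∃ W ∈ 𝓝 g, ∀ g' ∈ W, Matrix.det g' = 1 → covrad (latticeOf g') ≤ covrad (latticeOf g)

/-! ### Block upper triangular form -/

/-- Offset of the `i`-th diagonal block. -/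
def off {k : ℕ} (ns : Fin k → ℕ) (i : Fin k) : ℕ :=
  ∑ j ∈ Finset.univ.filter (fun j => j < i), ns j

lemma off_add_lt {k : ℕ} (ns : Fin k → ℕ) (i : Fin k) (a : Fin (ns i)) :
    off ns i + (a : ℕ) < ∑ j, ns j := by
  unfold off
  have hins : i ∉ Finset.univ.filter (fun j => j < i) := by simp
  have h2 : ∑ j ∈ insert i (Finset.univ.filter (fun j => j < i)), ns j ≤ ∑ j, ns j :=
    Finset.sum_le_sum_of_subset (Finset.subset_univ _)
  rw [Finset.sum_insert hins] at h2
  have := a.isLt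
  omega

/-- The position, in `Fin n`, of the `a`-th coordinate of the `i`-th block. -/
def blockEmb {n k : ℕ} (ns : Fin k → ℕ) (hsum : (∑ j, ns j) = n) (i : Fin k)
    (a : Fin (ns i)) : Fin n :=
  ⟨off ns i + (a : ℕ), hsum ▸ off_add_lt ns i a⟩

/-- `g` is block upper triangular with diagonal blocks `G i` (block sizes `ns`). -/
def IsBlockUT {n k : ℕ} (ns : Fin k → ℕ) (hsum : (∑ j, ns j) = n)
    (g : Matrix (Fin n) (Fin n) ℝ) (G : ∀ i, Matrix (Fin (ns i)) (Fin (ns i)) ℝ) : Prop :=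
  (∀ (i : Fin k) (a b : Fin (ns i)),
      g (blockEmb ns hsum i a) (blockEmb ns hsum i b) = G i a b) ∧
  (∀ (i j : Fin k) (a : Fin (ns i)) (b : Fin (ns j)), j < i →
      g (blockEmb ns hsum i a) (blockEmb ns hsum j b) = 0)

/-! ### Mordell constant -/

/-- The symmetric box `[-a₁,a₁] × ⋯ × [-aₙ,aₙ]` is admissible for `L`: its interior contains
no nonzero point of `L`. -/
def IsAdmissibleBox {n : ℕ} (L : AddSubgroup (Fin n → ℝ)) (a : Fin n → ℝ) : Prop :=
  (∀ i, 0 < a i) ∧ ∀ v ∈ L, v ≠ 0 → ∃ i, a i ≤ |v i|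

/-- The Mordell constant `κ(L) = 2⁻ⁿ sup { Vol(B) : B admissible symmetric box for L }`. -/
def mordellConst {n : ℕ} (L : AddSubgroup (Fin n → ℝ)) : ℝ :=
  (1 / 2 ^ n) * sSup {V | ∃ a : Fin n → ℝ, IsAdmissibleBox L a ∧ V = ∏ i, 2 * a i}

/-! ### Hermite constant -/

/-- Length of a shortest nonzero vector of `L`. -/
def shortest {m : ℕ} (L : AddSubgroup (Fin m → ℝ)) : ℝ :=
  sInf {t | ∃ w ∈ L, w ≠ 0 ∧ t = enorm w}

/-- The Hermite constant `γ_m`. -/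
def hermiteConst (m : ℕ) : ℝ :=
  sSup {c | ∃ L : AddSubgroup (Fin m → ℝ), IsUnimodularLattice L ∧ c = shortest L ^ 2}

/-! ### Korkine–Zolotarev reduction -/

/-- `v 0, …, v (n-1)` is a Korkine–Zolotarev reduced basis of `x`: it is a ℤ-basis, and for
each `i` the orthogonal projection of `v i` onto `span(v 0, …, v (i-1))^⊥` is shortest among the
nonzero such projections of vectors of `x` (projection lengths are expressed through Gram
determinants: the projection of `w` has length `gvol (v 0, …, v (i-1), w) / gvol (v 0, …, v (i-1))`). -/
def IsKZBasis {n : ℕ} (x : AddSubgroup (Fin n → ℝ)) (v : ℕ → (Fin n → ℝ)) : Prop :=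
  LinearIndependent ℝ (fun j : Fin n => v (j : ℕ)) ∧
  x = AddSubgroup.closure (v '' Set.Iio n) ∧
  ∀ i < n, ∀ w ∈ x, w ∉ Submodule.span ℝ (v '' Set.Iio i) →
    gvol (Fin.snoc (fun j : Fin i => v (j : ℕ)) (v i)) ≤
      gvol (Fin.snoc (fun j : Fin i => v (j : ℕ)) w)

/-- `A 0, …, A (n-1)` are the diagonal Korkine–Zolotarev coefficients of `x`: the lengths of
the successive orthogonal projections in a KZ reduced basis, i.e.
`A i = gvol (v 0, …, v i) / gvol (v 0, …, v (i-1))`. -/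
def HasKZCoeffs {n : ℕ} (x : AddSubgroup (Fin n → ℝ)) (A : ℕ → ℝ) : Prop :=
  ∃ v : ℕ → (Fin n → ℝ), IsKZBasis x v ∧
    ∀ i < n, A i * gvol (fun j : Fin i => v (j : ℕ)) = gvol (fun j : Fin (i + 1) => v (j : ℕ))

/-! ### Orthogonal complements and projections of lattices -/

/-- The orthogonal complement of a subspace `V ⊆ ℝⁿ`. -/
def orthoC {n : ℕ} (V : Submodule ℝ (Fin n → ℝ)) : Submodule ℝ (Fin n → ℝ) where
  carrier := {w | ∀ v ∈ V, einner w v = 0}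
  zero_mem' := by intro v hv; simp [einner]
  add_mem' := by intro a b ha hb v hv; rw [einner_add_left, ha v hv, hb v hv, add_zero]
  smul_mem' := by intro c w hw v hv; rw [einner_smul_left, hw v hv, mul_zero]

/-- The image `π(x)` of `x` under the orthogonal projection `π : ℝⁿ → V^⊥`:
`p = π(u)` iff `p ⊥ V` and `u - p ∈ V`. -/
def projLat {n : ℕ} (V : Submodule ℝ (Fin n → ℝ)) (x : AddSubgroup (Fin n → ℝ)) :
    AddSubgroup (Fin n → ℝ) where
  carrier := {p | (∀ v ∈ V, einner p v = 0) ∧ ∃ u ∈ x, u - p ∈ V}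
  zero_mem' := ⟨by intro v hv; simp [einner], 0, x.zero_mem, by rw [sub_zero]; exact V.zero_mem⟩
  add_mem' := by
    rintro p q ⟨hp1, u1, hu1, hp2⟩ ⟨hq1, u2, hu2, hq2⟩
    refine ⟨fun v hv => by rw [einner_add_left, hp1 v hv, hq1 v hv, add_zero],
      u1 + u2, x.add_mem hu1 hu2, ?_⟩
    have h : u1 + u2 - (p + q) = u1 - p + (u2 - q) := by abel
    rw [h]; exact V.add_mem hp2 hq2
  neg_mem' := by
    rintro p ⟨hp1, u, hu, hp2⟩
    refine ⟨fun v hv => by rw [einner_neg_left, hp1 v hv, neg_zero],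
      -u, x.neg_mem hu, ?_⟩
    have h : -u - -p = -(u - p) := by abel
    rw [h]; exact V.neg_mem hp2

/-! ### Cones over generic vectors -/

/-- `β` is a nonnegative combination of the labels `B v`, `v ∈ S`. -/
def InCone {V : Type*} {n : ℕ} (B : V → Fin n → ℝ) (β : Fin n → ℝ) (S : Finset V) : Prop :=
  ∃ x : V → ℝ, (∀ v ∈ S, 0 ≤ x v) ∧ ∑ v ∈ S, x v • B v = β

lemma sum_smul_mem_span {V : Type*} {n : ℕ} (B : V → Fin n → ℝ) (S : Finset V) (x : V → ℝ) :
    ∑ v ∈ S, x v • B v ∈ Submodule.span ℝ (B '' S) :=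
  Submodule.sum_mem _ fun _ hv =>
    Submodule.smul_mem _ _ (Submodule.subset_span (Set.mem_image_of_mem B hv))

lemma ne_zero_of_generic {V : Type*} [DecidableEq V] {n : ℕ} {B : V → Fin n → ℝ}
    {β : Fin n → ℝ} (hgen : ∀ T : Finset V, T.card < n → β ∉ Submodule.span ℝ (B '' T))
    {S : Finset V} (hS : S.card ≤ n) {x : V → ℝ} (hx : ∑ v ∈ S, x v • B v = β)
    {v : V} (hv : v ∈ S) : x v ≠ 0 := by
  intro h0
  refine hgen (S.erase v) ?_ ?_
  · have := Finset.card_erase_lt_of_mem hv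
    omega
  · rw [← hx, ← Finset.add_sum_erase _ _ hv, h0, zero_smul, zero_add]
    exact sum_smul_mem_span B _ x

lemma linearIndepOn_of_generic {V : Type*} [DecidableEq V] {n : ℕ} {B : V → Fin n → ℝ}
    {β : Fin n → ℝ} (hgen : ∀ T : Finset V, T.card < n → β ∉ Submodule.span ℝ (B '' T))
    {S : Finset V} (hS : S.card ≤ n) {x : V → ℝ} (hx : ∑ v ∈ S, x v • B v = β) :
    LinearIndepOn ℝ B (S : Set V) := by
  rw [linearIndepOn_finset_iff]
  intro f hf v hv
  by_contra hfv
  have h : ∑ u ∈ S, (x u - x v / f v * f u) • B u = β := by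
    simp_rw [sub_smul, mul_smul, Finset.sum_sub_distrib, ← Finset.smul_sum, hf, hx]
    simp
  exact ne_zero_of_generic hgen hS h hv (by field_simp; ring)

/-- Among the `n`-subsets of `n + 1` labels in an open half space, an even number contain a
given generic vector in their cone. -/
lemma even_card_inCone_erase {V : Type*} [DecidableEq V] {n : ℕ} {B : V → Fin n → ℝ}
    {β : Fin n → ℝ} (hgen : ∀ T : Finset V, T.card < n → β ∉ Submodule.span ℝ (B '' T))
    (ℓ : (Fin n → ℝ) →ₗ[ℝ] ℝ) (hℓ : ∀ v, 0 < ℓ (B v))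
    {T : Finset V} (hT : T.card = n + 1) [DecidablePred fun v => InCone B β (T.erase v)] :
    Even (T.filter fun v => InCone B β (T.erase v)).card := by
  by_cases hne : (T.filter fun v => InCone B β (T.erase v)) = ∅
  · simp [hne]
  obtain ⟨v₀, hv₀⟩ := Finset.nonempty_iff_ne_empty.2 hne
  obtain ⟨hv₀T, x, hx0, hx⟩ := Finset.mem_filter.1 hv₀
  have hcard : ∀ v ∈ T, (T.erase v).card = n := fun v hv => by
    rw [Finset.card_erase_of_mem hv, hT]; rfl
  have hxpos : ∀ v ∈ T.erase v₀, 0 < x v := fun v hv =>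
    lt_of_le_of_ne (hx0 v hv) (ne_zero_of_generic hgen (hcard v₀ hv₀T).le hx hv).symm
  have hli := linearIndepOn_of_generic hgen (hcard v₀ hv₀T).le hx
  have hspan : B v₀ ∈ Submodule.span ℝ (B '' (T.erase v₀ : Finset V)) := by
    have : Submodule.span ℝ (Set.range fun v : (T.erase v₀ : Finset V) => B v) = ⊤ := by
      refine LinearIndependent.span_eq_top_of_card_eq_finrank' hli ?_
      simp [hcard v₀ hv₀T]
    rw [Set.image_eq_range]
    change B v₀ ∈ Submodule.span ℝ (Set.range fun v : (T.erase v₀ : Finset V) => B v)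
    rw [this]; trivial
  obtain ⟨d, hd⟩ : ∃ d : V → ℝ, ∑ v ∈ T.erase v₀, d v • B v = B v₀ := by
    rw [Submodule.mem_span_image_finset_iff_exists_fun'] at hspan
    exact hspan
  have hdpos : ((T.erase v₀).filter fun v => 0 < d v).Nonempty := by
    by_contra hcon
    rw [Finset.not_nonempty_iff_eq_empty, Finset.filter_eq_empty_iff] at hcon
    have h1 := hℓ v₀
    rw [← hd, map_sum] at h1
    refine absurd h1 (not_lt.2 (Finset.sum_nonpos fun v hv => ?_))
    rw [map_smul, smul_eq_mul]
    exact mul_nonpos_of_nonpos_of_nonneg (not_lt.1 (hcon hv)) (hℓ v).le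
  obtain ⟨v₁, hv₁, hmin⟩ := Finset.exists_min_image _ (fun v => x v / d v) hdpos
  obtain ⟨hv₁e, hd₁⟩ := Finset.mem_filter.1 hv₁
  obtain ⟨hv₁₀, hv₁T⟩ := Finset.mem_erase.1 hv₁e
  have key : (T.filter fun v => InCone B β (T.erase v)) = {v₀, v₁} := by
    ext u
    simp only [Finset.mem_filter, Finset.mem_insert, Finset.mem_singleton]
    constructor
    · rintro ⟨huT, z, hz0, hz⟩
      by_contra! hu
      obtain ⟨hu0, hu1⟩ := hu
      have hue : u ∈ T.erase v₀ := Finset.mem_erase.2 ⟨hu0, huT⟩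
      set z' : V → ℝ := fun v => if v = u then 0 else z v with hz'
      have hzT : ∑ v ∈ T, z' v • B v = β := by
        rw [← Finset.add_sum_erase _ _ huT, ← hz]
        simp only [hz', if_true, zero_smul, zero_add]
        exact Finset.sum_congr rfl fun v hv => by rw [if_neg (Finset.ne_of_mem_erase hv)]
      have hz'0 : ∀ v ∈ T, 0 ≤ z' v := fun v hv => by
        by_cases h : v = u
        · simp [hz', h]
        · simpa [hz', h] using hz0 v (Finset.mem_erase.2 ⟨h, hv⟩)
      have hrel : ∀ v ∈ T.erase v₀, z' v + z' v₀ * d v - x v = 0 := by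
        refine (linearIndepOn_finset_iff.1 hli) (fun v => z' v + z' v₀ * d v - x v) ?_
        simp_rw [sub_smul, add_smul, mul_smul, Finset.sum_sub_distrib, Finset.sum_add_distrib,
          ← Finset.smul_sum, hd, hx]
        rw [add_comm, Finset.add_sum_erase _ (fun v => z' v • B v) hv₀T, hzT, sub_self]
      have hu' := hrel u hue
      have h1' := hrel v₁ hv₁e
      have hzu : z' u = 0 := by simp [hz']
      have hs := hz'0 v₀ hv₀T
      have hxu := hxpos u hue
      have hdu : 0 < d u := by
        by_contra hcon
        nlinarith [mul_nonneg hs (neg_nonneg.2 (not_lt.1 hcon))]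
      have hle := hmin u (Finset.mem_filter.2 ⟨hue, hdu⟩)
      have hsu : z' v₀ = x u / d u := by field_simp; linarith
      have hz1 : z' v₁ = 0 := by
        refine le_antisymm ?_ (hz'0 v₁ hv₁T)
        rw [← hsu, div_le_iff₀ hd₁] at hle
        linarith
      have := ne_zero_of_generic hgen (hcard u huT).le hz (Finset.mem_erase.2 ⟨hu1.symm, hv₁T⟩)
      apply this
      simpa [hz', hu1.symm] using hz1
    · rintro (rfl | rfl)
      · exact ⟨hv₀T, x, hx0, hx⟩
      · refine ⟨hv₁T, fun v => if v = v₀ then x u / d u else x v - x u / d u * d v, ?_, ?_⟩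
        · intro v hv
          have hxu := hxpos u hv₁e
          by_cases h : v = v₀
          · simp only [h, if_true]; positivity
          · simp only [h, if_false]
            have hve : v ∈ T.erase v₀ := Finset.mem_erase.2 ⟨h, Finset.mem_of_mem_erase hv⟩
            by_cases hdv : 0 < d v
            · have := hmin v (Finset.mem_filter.2 ⟨hve, hdv⟩)
              rw [le_div_iff₀ hdv] at this
              linarith
            · have h1 := hxpos v hve
              have h2 : 0 ≤ x u / d u := by positivity
              nlinarith [mul_nonneg h2 (neg_nonneg.2 (not_lt.1 hdv))]
        · have h1 : ∑ v ∈ T, (if v = v₀ then x u / d u else x v - x u / d u * d v) • B v = β := by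
            rw [← Finset.add_sum_erase _ _ hv₀T]
            have : ∑ v ∈ T.erase v₀,
                (if v = v₀ then x u / d u else x v - x u / d u * d v) • B v
                = ∑ v ∈ T.erase v₀, (x v - x u / d u * d v) • B v :=
              Finset.sum_congr rfl fun v hv => by rw [if_neg (Finset.ne_of_mem_erase hv)]
            rw [this]
            simp_rw [sub_smul, mul_smul, Finset.sum_sub_distrib, ← Finset.smul_sum, hd, hx]
            simp
          rw [← Finset.add_sum_erase _ _ hv₁T, if_neg hv₁₀] at h1
          rw [← h1, div_mul_cancel₀ _ hd₁.ne', sub_self, zero_smul, zero_add]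
  rw [key, Finset.card_pair hv₁₀.symm]
  exact even_two

/-! ### Dominating sets -/

/-- `S` is dominating for the family of orders `k`: no element lies strictly below the maximum
of `S` for every order. -/
def Dominating {ι V α : Type*} [LE α] (k : ι → V → α) (S : Finset V) : Prop :=
  ∀ w, ∃ i, ∀ s ∈ S, k i s ≤ k i w

lemma Dominating.mono {ι V α : Type*} [LE α] {k : ι → V → α} {S T : Finset V}
    (hT : Dominating k T) (h : S ⊆ T) : Dominating k S := fun w =>
  (hT w).imp fun _ hi s hs => hi s (h hs)

/-- The elements lying strictly below `m i` for all orders `i ≠ r`. -/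
def below {ι V α : Type*} [LT α] (k : ι → V → α) (m : ι → V) (r : ι) : Set V :=
  {w | ∀ i, i ≠ r → k i w < k i (m i)}

section Extension

variable {ι V α : Type*} [LinearOrder α] {k : ι → V → α} {m : ι → V}

lemma exists_isLeast_below [Finite V] {r : ι} (h : (below k m r).Nonempty) :
    ∃ v ∈ below k m r, ∀ w ∈ below k m r, k r v ≤ k r w :=
  Set.exists_min_image _ _ (Set.toFinite _) h

variable [DecidableEq V] (hk : ∀ i, Function.Injective (k i)) {τ : Finset V} {p q : ι}

include hk in
lemma dominating_insert_iff (hτ : Dominating k τ)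
    (hm : ∀ i, m i ∈ τ) (hmax : ∀ i, ∀ s ∈ τ, k i s ≤ k i (m i))
    (hpq : p ≠ q) (hmpq : m p = m q)
    (hp : ∀ i j, i ≠ p → j ≠ p → m i = m j → i = j) {v : V} :
    (v ∉ τ ∧ Dominating k (insert v τ)) ↔
      ∃ r, (r = p ∨ r = q) ∧ v ∈ below k m r ∧ ∀ w ∈ below k m r, k r v ≤ k r w := by
  have hidx : ∀ t ∈ τ, ∀ i, (∀ s ∈ τ, k i s ≤ k i t) → m i = t := fun t ht i hi =>
    hk i (le_antisymm (hi _ (hm i)) (hmax i t ht))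
  have hq : ∀ i j, i ≠ q → j ≠ q → m i = m j → i = j := by
    intro i j hi hj hij
    by_cases h1 : i = p
    · by_cases h2 : j = p
      · rw [h1, h2]
      · exact absurd (hp j q h2 hpq.symm (by rw [← hij, h1, hmpq])) hj
    · by_cases h2 : j = p
      · exact absurd (hp i q h1 hpq.symm (by rw [hij, h2, hmpq])) hi
      · exact hp i j h1 h2 hij
  have hother : ∀ r, (r = p ∨ r = q) → ∃ r', r' ≠ r ∧ m r' = m r := by
    rintro r (rfl | rfl)
    · exact ⟨q, hpq.symm, hmpq.symm⟩
    · exact ⟨p, hpq, hmpq⟩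
  constructor
  · rintro ⟨hv, hdom⟩
    have hlt : ∀ j, ∃ i, m i = m j ∧ k i v < k i (m i) := by
      intro j
      obtain ⟨i, hi⟩ := hdom (m j)
      have hmi := hidx (m j) (hm j) i fun s hs => hi s (Finset.mem_insert_of_mem hs)
      refine ⟨i, hmi, lt_of_le_of_ne ?_ fun h => hv ?_⟩
      · rw [hmi]; exact hi v (Finset.mem_insert_self _ _)
      · rw [hk i h]; exact hm i
    have hmin : ∀ r, v ∈ below k m r → ∀ w ∈ below k m r, k r v ≤ k r w := by
      intro r _ w hw
      obtain ⟨i, hi⟩ := hdom w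
      have : i = r := by
        by_contra hir
        exact absurd (hi _ (Finset.mem_insert_of_mem (hm i))) (not_le.2 (hw i hir))
      subst this
      exact hi v (Finset.mem_insert_self _ _)
    obtain ⟨i₀, hi₀, hv₀⟩ := hlt p
    by_cases hip : i₀ = p
    · refine ⟨q, Or.inr rfl, ?_, hmin q ?_⟩ <;>
      · intro j hj
        obtain ⟨i, hi, hvi⟩ := hlt j
        by_cases hiq : i = q
        · have : j = p := by
            by_contra hjp
            exact hj (hp j q hjp hpq.symm (by rw [← hi, hiq]))
          rw [this, ← hip]; exact hv₀
        · rwa [← hq i j hiq hj hi]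
    · have hiq : i₀ = q := hp i₀ q hip hpq.symm (by rw [hi₀, hmpq])
      refine ⟨p, Or.inl rfl, ?_, hmin p ?_⟩ <;>
      · intro j hj
        obtain ⟨i, hi, hvi⟩ := hlt j
        by_cases hip' : i = p
        · have : j = q := hp j q hj hpq.symm (by rw [← hi, hip', hmpq])
          rw [this, ← hiq]; exact hv₀
        · rwa [← hp i j hip' hj hi]
  · rintro ⟨r, hr, hvr, hvmin⟩
    refine ⟨fun hvτ => ?_, fun w => ?_⟩
    · obtain ⟨i, hi⟩ := hτ v
      have hmi := hidx v hvτ i hi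
      by_cases hir : i = r
      · obtain ⟨r', hr', hmr'⟩ := hother r hr
        have := hvr r' hr'
        rw [hmr', ← hir, hmi] at this
        exact lt_irrefl _ this
      · have := hvr i hir
        rw [hmi] at this
        exact lt_irrefl _ this
    · by_cases hw : w ∈ below k m r
      · obtain ⟨i, hi⟩ := hτ w
        have hir : i = r := by
          by_contra hir
          exact absurd (hi _ (hm i)) (not_le.2 (hw i hir))
        subst hir
        refine ⟨i, fun s hs => ?_⟩
        rcases Finset.mem_insert.1 hs with rfl | hs
        · exact hvmin w hw
        · exact hi s hs
      · simp only [below, Set.mem_ofPred_eq, not_forall, not_lt] at hw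
        obtain ⟨i, hir, hi⟩ := hw
        refine ⟨i, fun s hs => ?_⟩
        rcases Finset.mem_insert.1 hs with rfl | hs
        · exact (hvr i hir).le.trans hi
        · exact (hmax i s hs).trans hi

variable [Fintype V]

include hk in
lemma card_extensions_eq_two [DecidablePred fun v => v ∉ τ ∧ Dominating k (insert v τ)]
    (hτ : Dominating k τ)
    (hm : ∀ i, m i ∈ τ) (hmax : ∀ i, ∀ s ∈ τ, k i s ≤ k i (m i))
    (hpq : p ≠ q) (hmpq : m p = m q)
    (hp : ∀ i j, i ≠ p → j ≠ p → m i = m j → i = j)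
    (hPne : (below k m p).Nonempty) (hQne : (below k m q).Nonempty) :
    (Finset.univ.filter fun v => v ∉ τ ∧ Dominating k (insert v τ)).card = 2 := by
  obtain ⟨a, ha, hamin⟩ := exists_isLeast_below hPne
  obtain ⟨b, hb, hbmin⟩ := exists_isLeast_below hQne
  have hab : a ≠ b := by
    rintro rfl
    obtain ⟨i, hi⟩ := hτ a
    refine absurd (hi _ (hm i)) (not_le.2 ?_)
    by_cases hip : i = p
    · exact hb i (by rw [hip]; exact hpq)
    · exact ha i hip
  rw [← Finset.card_pair hab]
  congr 1
  ext v
  simp only [Finset.mem_filter, Finset.mem_univ, true_and,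
    dominating_insert_iff hk hτ hm hmax hpq hmpq hp, Finset.mem_insert, Finset.mem_singleton]
  constructor
  · rintro ⟨r, rfl | rfl, hv, hvmin⟩
    · exact Or.inl (hk r (le_antisymm (hvmin a ha) (hamin v hv)))
    · exact Or.inr (hk r (le_antisymm (hvmin b hb) (hbmin v hv)))
  · rintro (rfl | rfl)
    · exact ⟨p, Or.inl rfl, ha, hamin⟩
    · exact ⟨q, Or.inr rfl, hb, hbmin⟩

include hk in
lemma card_extensions_eq_one [DecidablePred fun v => v ∉ τ ∧ Dominating k (insert v τ)]
    (hτ : Dominating k τ)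
    (hm : ∀ i, m i ∈ τ) (hmax : ∀ i, ∀ s ∈ τ, k i s ≤ k i (m i))
    (hpq : p ≠ q) (hmpq : m p = m q)
    (hp : ∀ i j, i ≠ p → j ≠ p → m i = m j → i = j)
    (hPne : (below k m p).Nonempty) (hQ : below k m q = ∅) :
    (Finset.univ.filter fun v => v ∉ τ ∧ Dominating k (insert v τ)).card = 1 := by
  obtain ⟨a, ha, hamin⟩ := exists_isLeast_below hPne
  rw [Finset.card_eq_one]
  refine ⟨a, ?_⟩
  ext v
  simp only [Finset.mem_filter, Finset.mem_univ, true_and,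
    dominating_insert_iff hk hτ hm hmax hpq hmpq hp, Finset.mem_singleton]
  constructor
  · rintro ⟨r, rfl | rfl, hv, hvmin⟩
    · exact hk r (le_antisymm (hvmin a ha) (hamin v hv))
    · rw [hQ] at hv; exact hv.elim
  · rintro rfl
    exact ⟨p, Or.inl rfl, ha, hamin⟩

end Extension

/-- A set of `n - 1` elements extends to a dominating `n`-set in an even number of ways, unless
it consists of slack elements `σ j`, in which case it does so in an odd number of ways. -/
lemma card_extensions_mod_two {n : ℕ} (hn : 2 ≤ n) {V α : Type*} [Fintype V] [DecidableEq V]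
    [LinearOrder α] {k : Fin n → V → α} (hk : ∀ i, Function.Injective (k i)) {σ : Fin n → V}
    (htop : ∀ i v, v ≠ σ i → k i v < k i (σ i))
    (hbot : ∀ i j v, j ≠ i → v ∉ Set.range σ → k i (σ j) < k i v)
    (hσ : Function.Injective σ) {τ : Finset V} (hτ : τ.card + 1 = n)
    [DecidablePred fun v => v ∉ τ ∧ Dominating k (insert v τ)]
    [Decidable (τ ⊆ Finset.univ.image σ)] :
    ((Finset.univ.filter fun v => v ∉ τ ∧ Dominating k (insert v τ)).card : ZMod 2) =
      if τ ⊆ Finset.univ.image σ then 1 else 0 := by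
  have hslack : τ ⊆ Finset.univ.image σ → ∃ i₀, σ i₀ ∉ τ ∧ ∀ j, j ≠ i₀ → σ j ∈ τ := by
    intro hsub
    have hc : (Finset.univ.image σ \ τ).card = 1 := by
      rw [Finset.card_sdiff_of_subset hsub, Finset.card_image_of_injective _ hσ]
      simp; omega
    obtain ⟨a, ha⟩ := Finset.card_eq_one.1 hc
    have ha' : a ∈ Finset.univ.image σ \ τ := by rw [ha]; simp
    obtain ⟨ha1, ha2⟩ := Finset.mem_sdiff.1 ha'
    obtain ⟨i₀, -, rfl⟩ := Finset.mem_image.1 ha1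
    refine ⟨i₀, ha2, fun j hj => ?_⟩
    by_contra hjτ
    have : σ j ∈ Finset.univ.image σ \ τ := Finset.mem_sdiff.2 ⟨by simp, hjτ⟩
    rw [ha, Finset.mem_singleton] at this
    exact hj (hσ this)
  by_cases hdom : Dominating k τ
  swap
  · have h0 : (Finset.univ.filter fun v => v ∉ τ ∧ Dominating k (insert v τ)) = ∅ :=
      Finset.filter_eq_empty_iff.2 fun v _ h => hdom (h.2.mono (Finset.subset_insert _ _))
    rw [h0, if_neg, Finset.card_empty, Nat.cast_zero]
    intro hsub
    obtain ⟨i₀, hi₀, hi⟩ := hslack hsub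
    refine hdom fun w => ?_
    by_cases hw : ∃ j, j ≠ i₀ ∧ w = σ j
    · obtain ⟨j, -, rfl⟩ := hw
      refine ⟨j, fun s _ => ?_⟩
      by_cases hs : s = σ j
      · rw [hs]
      · exact (htop j s hs).le
    · refine ⟨i₀, fun s hs => ?_⟩
      obtain ⟨j, -, rfl⟩ := Finset.mem_image.1 (hsub hs)
      have hj : j ≠ i₀ := by rintro rfl; exact hi₀ hs
      by_cases hwi : w = σ i₀
      · rw [hwi]; exact (htop i₀ _ fun h => hj (hσ h)).le
      · refine (hbot i₀ j w hj ?_).le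
        rintro ⟨l, rfl⟩
        exact hw ⟨l, fun h => hwi (by rw [h]), rfl⟩
  have hne : τ.Nonempty := Finset.card_pos.1 (by omega)
  choose m hm hmax using fun i => Finset.exists_max_image τ (k i) hne
  have hsurj : ∀ t ∈ τ, ∃ i, m i = t := fun t ht => by
    obtain ⟨i, hi⟩ := hdom t
    exact ⟨i, hk i (le_antisymm (hi _ (hm i)) (hmax i t ht))⟩
  have hcol : ∃ p q, p ≠ q ∧ m p = m q := by
    obtain ⟨p, -, q, -, h, h'⟩ := Finset.exists_ne_map_eq_of_card_lt_of_maps_to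
      (s := (Finset.univ : Finset (Fin n))) (t := τ) (f := m) (by simp; omega)
      (fun i _ => hm i)
    exact ⟨p, q, h, h'⟩
  have hinj : ∀ p q, p ≠ q → m p = m q → ∀ i j, i ≠ p → j ≠ p → m i = m j → i = j := by
    intro p q hpq hmpq i j hi hj hij
    have himg : (Finset.univ.erase p).image m = τ := by
      ext t
      simp only [Finset.mem_image, Finset.mem_erase, Finset.mem_univ, and_true]
      constructor
      · rintro ⟨i, -, rfl⟩; exact hm i
      · intro ht
        obtain ⟨l, rfl⟩ := hsurj t ht
        by_cases hl : l = p
        · exact ⟨q, hpq.symm, by rw [hl, hmpq]⟩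
        · exact ⟨l, hl, rfl⟩
    have hi' : Set.InjOn m (Finset.univ.erase p : Finset (Fin n)) := by
      rw [← Finset.card_image_iff, himg, Finset.card_erase_of_mem (Finset.mem_univ _)]
      simp; omega
    exact hi' (by simpa using hi) (by simpa using hj) hij
  by_cases hsub : τ ⊆ Finset.univ.image σ
  · rw [if_pos hsub]
    obtain ⟨i₀, hi₀, hi⟩ := hslack hsub
    have hmσ : ∀ j, j ≠ i₀ → m j = σ j := by
      intro j hj
      by_contra h
      exact absurd (hmax j _ (hi j hj)) (not_le.2 (htop j _ h))
    obtain ⟨q, hq, hmq⟩ : ∃ q, i₀ ≠ q ∧ m i₀ = m q := by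
      obtain ⟨j, -, hj⟩ := Finset.mem_image.1 (hsub (hm i₀))
      have hj0 : j ≠ i₀ := by rintro rfl; exact hi₀ (hj ▸ hm j)
      exact ⟨j, hj0.symm, by rw [hmσ j hj0, hj]⟩
    rw [card_extensions_eq_one hk hdom hm hmax hq hmq (hinj i₀ q hq hmq), Nat.cast_one]
    · refine ⟨σ i₀, fun j hj => ?_⟩
      rw [hmσ j hj]
      exact htop j _ fun h => hj (hσ h).symm
    · rw [Set.eq_empty_iff_forall_notMem]
      intro w hw
      have h0 := hw i₀ hq
      rw [hmq, hmσ q hq.symm] at h0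
      by_cases hwr : w ∈ Set.range σ
      · obtain ⟨l, rfl⟩ := hwr
        by_cases hl0 : l = i₀
        · rw [hl0] at h0
          exact lt_asymm h0 (htop i₀ _ fun h => hq (hσ h).symm)
        by_cases hlq : l = q
        · rw [hlq] at h0; exact lt_irrefl _ h0
        · have := hw l hlq
          rw [hmσ l hl0] at this
          exact lt_irrefl _ this
      · exact lt_asymm h0 (hbot i₀ q w hq.symm hwr)
  · rw [if_neg hsub]
    obtain ⟨p, q, hpq, hmpq⟩ := hcol
    obtain ⟨s, hs, hsσ⟩ := Finset.not_subset.1 hsub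
    have hN : ∀ r, (below k m r).Nonempty := fun r =>
      ⟨σ r, fun i hi => (hbot i r s hi.symm (by simpa using hsσ)).trans_le (hmax i s hs)⟩
    rw [card_extensions_eq_two hk hdom hm hmax hpq hmpq (hinj p q hpq hmpq) (hN p) (hN q)]
    rfl

/-! ### Scarf's lemma -/

open Classical in
/-- **Scarf's lemma**, for strict orders. -/
lemma exists_dominating_inCone {n : ℕ} (hn : 2 ≤ n) {V α : Type*} [Fintype V]
    [LinearOrder α] {k : Fin n → V → α} (hk : ∀ i, Function.Injective (k i)) {σ : Fin n → V}
    (htop : ∀ i v, v ≠ σ i → k i v < k i (σ i))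
    (hbot : ∀ i j v, j ≠ i → v ∉ Set.range σ → k i (σ j) < k i v)
    (hσ : Function.Injective σ) {B : V → Fin n → ℝ} {β : Fin n → ℝ}
    (hgen : ∀ T : Finset V, T.card < n → β ∉ Submodule.span ℝ (B '' T))
    (ℓ : (Fin n → ℝ) →ₗ[ℝ] ℝ) (hℓ : ∀ v, 0 < ℓ (B v))
    (hβ : InCone B β (Finset.univ.image σ)) :
    ∃ S : Finset V, S.card = n ∧ Dominating k S ∧ InCone B β S := by
  set G : Finset V → ZMod 2 := fun S => if InCone B β S then 1 else 0 with hG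
  set v₀ : V := σ ⟨0, by omega⟩
  have hGsmall : ∀ S : Finset V, S.card < n → G S = 0 := by
    intro S hS
    refine if_neg ?_
    rintro ⟨x, -, hx⟩
    exact hgen S hS (hx ▸ sum_smul_mem_span B S x)
  have hstep : ∀ S : Finset V, S.card = n → ∑ v ∈ S, G (insert v₀ (S.erase v)) = G S := by
    intro S hS
    by_cases hv : v₀ ∈ S
    · rw [← Finset.add_sum_erase _ _ hv, Finset.insert_erase hv, Finset.sum_eq_zero, add_zero]
      intro v hvS
      obtain ⟨h1, h2⟩ := Finset.mem_erase.1 hvS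
      apply hGsmall
      rw [Finset.insert_eq_of_mem (Finset.mem_erase.2 ⟨h1.symm, hv⟩), ← hS]
      exact Finset.card_erase_lt_of_mem h2
    · have h := even_card_inCone_erase hgen ℓ hℓ (T := insert v₀ S)
        (by rw [Finset.card_insert_of_notMem hv, hS])
      rw [← ZMod.natCast_eq_zero_iff_even, Finset.card_filter, Nat.cast_sum,
        Finset.sum_insert hv, Finset.erase_insert hv] at h
      have h' : ∑ v ∈ S, G (insert v₀ (S.erase v)) =
          ∑ v ∈ S, ((if InCone B β ((insert v₀ S).erase v) then 1 else 0 : ℕ) : ZMod 2) := by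
        refine Finset.sum_congr rfl fun v hvS => ?_
        rw [Finset.erase_insert_of_ne (by rintro rfl; exact hv hvS)]
        simp [hG]
      rw [h']
      have h2 : G S + ∑ v ∈ S, ((if InCone B β ((insert v₀ S).erase v) then 1 else 0 : ℕ) : ZMod 2)
          = 0 := by rw [← h]; simp [hG]
      rw [← sub_eq_zero, CharTwo.sub_eq_add, add_comm, h2]
  set E : Finset V := Finset.univ.image σ with hE
  have hEc : E.card = n := by rw [hE, Finset.card_image_of_injective _ hσ]; simp
  have hdeg := fun (τ : Finset V) (hτ : τ.card + 1 = n) =>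
    card_extensions_mod_two hn hk htop hbot hσ hτ
  set D := Finset.univ.filter fun S : Finset V => S.card = n ∧ Dominating k S with hD
  set F := Finset.univ.filter fun τ : Finset V => τ.card + 1 = n with hF
  have h1 : ∑ S ∈ D, ∑ v ∈ S, G (insert v₀ (S.erase v)) =
      ∑ τ ∈ F, ∑ v ∈ Finset.univ.filter (fun v => v ∉ τ ∧ Dominating k (insert v τ)),
        G (insert v₀ τ) := by
    rw [Finset.sum_sigma', Finset.sum_sigma']
    refine Finset.sum_bij' (fun p _ => ⟨p.1.erase p.2, p.2⟩) (fun p _ => ⟨insert p.2 p.1, p.2⟩)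
      ?_ ?_ ?_ ?_ ?_
    · rintro ⟨S, v⟩ h
      simp only [hD, hF, Finset.mem_sigma, Finset.mem_filter, Finset.mem_univ, true_and] at h ⊢
      obtain ⟨⟨hc, hd⟩, hv⟩ := h
      refine ⟨?_, Finset.notMem_erase _ _, by rwa [Finset.insert_erase hv]⟩
      rw [Finset.card_erase_add_one hv, hc]
    · rintro ⟨τ, v⟩ h
      simp only [hD, hF, Finset.mem_sigma, Finset.mem_filter, Finset.mem_univ, true_and] at h ⊢
      obtain ⟨hc, hv, hd⟩ := h
      exact ⟨⟨by rw [Finset.card_insert_of_notMem hv, hc], hd⟩, Finset.mem_insert_self _ _⟩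
    · rintro ⟨S, v⟩ h
      simp only [Finset.mem_sigma] at h
      simp [Finset.insert_erase h.2]
    · rintro ⟨τ, v⟩ h
      simp only [Finset.mem_sigma, Finset.mem_filter] at h
      simp [Finset.erase_insert h.2.2.1]
    · rintro ⟨S, v⟩ h
      rfl
  have h2 : ∑ τ ∈ F, ∑ v ∈ Finset.univ.filter (fun v => v ∉ τ ∧ Dominating k (insert v τ)),
        G (insert v₀ τ) = ∑ v ∈ E, G (insert v₀ (E.erase v)) := by
    have : ∀ τ ∈ F, ∑ v ∈ Finset.univ.filter (fun v => v ∉ τ ∧ Dominating k (insert v τ)),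
        G (insert v₀ τ) = if τ ⊆ E then G (insert v₀ τ) else 0 := by
      intro τ hτ
      rw [Finset.sum_const, nsmul_eq_mul, hdeg τ (Finset.mem_filter.1 hτ).2]
      split_ifs <;> simp
    rw [Finset.sum_congr rfl this, ← Finset.sum_filter]
    symm
    refine Finset.sum_bij (fun v _ => E.erase v) ?_ ?_ ?_ ?_
    · intro v hv
      simp only [hF, Finset.mem_filter, Finset.mem_univ, true_and]
      exact ⟨by rw [Finset.card_erase_add_one hv, hEc], Finset.erase_subset _ _⟩
    · intro v hv w hw h
      by_contra hne
      have : v ∈ E.erase w := Finset.mem_erase.2 ⟨hne, hv⟩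
      rw [← h] at this
      exact Finset.notMem_erase _ _ this
    · intro τ hτ
      simp only [hF, Finset.mem_filter, Finset.mem_univ, true_and] at hτ
      obtain ⟨hc, hs⟩ := hτ
      have hsd : (E \ τ).card = 1 := by rw [Finset.card_sdiff_of_subset hs]; omega
      obtain ⟨a, ha⟩ := Finset.card_eq_one.1 hsd
      have ha' : a ∈ E \ τ := by rw [ha]; simp
      refine ⟨a, (Finset.mem_sdiff.1 ha').1, ?_⟩
      rw [Finset.erase_eq, ← ha, Finset.sdiff_sdiff_eq_self hs]
    · intro v hv
      rfl
  rw [h2, hstep E hEc] at h1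
  have h3 : G E = 1 := if_pos hβ
  rw [h3] at h1
  obtain ⟨S, hS, hne⟩ := Finset.exists_ne_zero_of_sum_ne_zero (h1.trans_ne one_ne_zero)
  obtain ⟨-, hSc, hSd⟩ := Finset.mem_filter.1 hS
  refine ⟨S, hSc, hSd, ?_⟩
  rw [hstep S hSc] at hne
  by_contra hcon
  exact hne (if_neg hcon)

/-- **Scarf's lemma**, for preorders given by real-valued functions. -/
lemma exists_dominating_inCone_real {n : ℕ} (hn : 2 ≤ n) {V : Type*} [Fintype V]
    {g : Fin n → V → ℝ} {σ : Fin n → V}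
    (htop : ∀ i v, v ≠ σ i → g i v < g i (σ i))
    (hbot : ∀ i j v, j ≠ i → v ∉ Set.range σ → g i (σ j) < g i v)
    (hσ : Function.Injective σ) {B : V → Fin n → ℝ} {β : Fin n → ℝ}
    (hgen : ∀ T : Finset V, T.card < n → β ∉ Submodule.span ℝ (B '' T))
    (ℓ : (Fin n → ℝ) →ₗ[ℝ] ℝ) (hℓ : ∀ v, 0 < ℓ (B v))
    (hβ : ∃ x : Fin n → ℝ, (∀ i, 0 ≤ x i) ∧ ∑ i, x i • B (σ i) = β) :
    ∃ S : Finset V, S.card = n ∧ Dominating g S ∧ InCone B β S := by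
  classical
  let e := Fintype.equivFin V
  let k : Fin n → V → ℝ ×ₗ Fin (Fintype.card V) := fun i v => toLex (g i v, e v)
  have hlt : ∀ i v w, g i v < g i w → k i v < k i w := fun i v w h =>
    Prod.Lex.toLex_lt_toLex.2 (Or.inl h)
  have hβ' : InCone B β (Finset.univ.image σ) := by
    obtain ⟨x, hx0, hx⟩ := hβ
    refine ⟨fun v => Function.extend σ x 0 v, ?_, ?_⟩
    · intro v hv
      obtain ⟨i, -, rfl⟩ := Finset.mem_image.1 hv
      simpa [hσ.extend_apply] using hx0 i
    · rw [Finset.sum_image (fun a _ b _ h => hσ h), ← hx]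
      simp [hσ.extend_apply]
  obtain ⟨S, hS, hd, hc⟩ := exists_dominating_inCone hn (k := k) (σ := σ)
    (fun i v w h => e.injective (congrArg Prod.snd (toLex.injective h)))
    (fun i v hv => hlt _ _ _ (htop i v hv)) (fun i j v hj hv => hlt _ _ _ (hbot i j v hj hv))
    hσ hgen ℓ hℓ (by convert hβ')
  refine ⟨S, hS, fun w => ?_, hc⟩
  obtain ⟨i, hi⟩ := hd w
  refine ⟨i, fun s hs => ?_⟩
  rcases Prod.Lex.toLex_le_toLex.1 (hi s hs) with h | h
  · exact h.le
  · exact h.1.le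

open MeasureTheory

/-! ### Lattices, Minkowski's theorem and Hadamard's inequality -/

lemma gvol_eq_abs_det {n : ℕ} (v : Fin n → Fin n → ℝ) : gvol v = |(Matrix.of v).det| := by
  have : (Matrix.of fun i j => einner (v i) (v j)) = Matrix.of v * (Matrix.of v)ᵀ := by
    ext i j
    simp [einner, Matrix.mul_apply]
  rw [gvol, this, Matrix.det_mul, Matrix.det_transpose, ← sq, Real.sqrt_sq_eq_abs]

/-- The covolume spectrum of a lattice consists of the determinants of its bases. -/
lemma covolSpec.exists_basis {n : ℕ} {L : AddSubgroup (Fin n → ℝ)} (hL : IsLattice L) {c : ℝ}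
    (hc : covolSpec L c) : ∃ b : Module.Basis (Fin n) ℝ (Fin n → ℝ),
      L = AddSubgroup.closure (Set.range b) ∧ c = |(Matrix.of ⇑b).det| := by
  obtain ⟨r, v, hli, hLv, rfl⟩ := hc
  have hspan : Submodule.span ℝ (Set.range v) = ⊤ := by
    rw [eq_top_iff, ← hL.2, Submodule.span_le]
    intro w hw
    rw [hLv] at hw
    have : AddSubgroup.closure (Set.range v) ≤ (Submodule.span ℝ (Set.range v)).toAddSubgroup :=
      (AddSubgroup.closure_le _).2 Submodule.subset_span
    exact this hw
  have hr : r = n := by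
    have := finrank_span_eq_card hli
    rw [hspan, finrank_top] at this
    simpa using this.symm
  subst hr
  refine ⟨Module.Basis.mk hli hspan.ge, ?_, ?_⟩
  · simpa using hLv
  · simp [gvol_eq_abs_det]

lemma IsUnimodularLattice.covolSpec_nonempty {n : ℕ} {L : AddSubgroup (Fin n → ℝ)}
    (hL : IsUnimodularLattice L) : {c | covolSpec L c}.Nonempty := by
  by_contra h
  have h1 := hL.2
  rw [covol, Set.not_nonempty_iff_eq_empty.1 h, Real.sInf_empty] at h1
  exact zero_ne_one h1

lemma IsUnimodularLattice.one_le_of_covolSpec {n : ℕ} {L : AddSubgroup (Fin n → ℝ)}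
    (hL : IsUnimodularLattice L) {c : ℝ} (hc : covolSpec L c) : 1 ≤ c := by
  rw [← hL.2]
  refine csInf_le ⟨0, ?_⟩ hc
  rintro _ ⟨r, v, -, -, rfl⟩
  exact Real.sqrt_nonneg _

/-- **Minkowski's theorem** for boxes. -/
lemma IsUnimodularLattice.exists_abs_lt {n : ℕ} {L : AddSubgroup (Fin n → ℝ)}
    (hL : IsUnimodularLattice L) {a : Fin n → ℝ} (ha : ∀ i, 0 < a i) (h1 : 1 < ∏ i, a i) :
    ∃ w ∈ L, w ≠ 0 ∧ ∀ i, |w i| < a i := by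
  obtain ⟨c, hc, hca⟩ := exists_lt_of_csInf_lt hL.covolSpec_nonempty
    (show sInf {c | covolSpec L c} < ∏ i, a i from hL.2.trans_lt h1)
  obtain ⟨b, hLb, rfl⟩ := covolSpec.exists_basis hL.1 hc
  have hLs : L = (Submodule.span ℤ (Set.range b)).toAddSubgroup := by
    rw [hLb, Submodule.span_int_eq_addSubgroupClosure]
  have : Countable (Submodule.span ℤ (Set.range b)).toAddSubgroup :=
    inferInstanceAs (Countable (Submodule.span ℤ (Set.range b)))
  have hF := ZSpan.isAddFundamentalDomain' b (volume : Measure (Fin n → ℝ))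
  have hvol : volume (Set.univ.pi fun i => Set.Ioo (-a i) (a i))
      = ENNReal.ofReal (∏ i, a i) * 2 ^ n := by
    rw [Real.volume_pi_Ioo, ← ENNReal.ofReal_prod_of_nonneg (fun i _ => by linarith [ha i])]
    have : ∏ i, (a i - -a i) = (∏ i, a i) * 2 ^ n := by
      simp_rw [sub_neg_eq_add, ← mul_two, Finset.prod_mul_distrib]
      simp
    rw [this, ENNReal.ofReal_mul (Finset.prod_nonneg fun i _ => (ha i).le)]
    congr 1
    rw [ENNReal.ofReal_pow (by norm_num)]
    simp
  have hsymm : ∀ x ∈ Set.univ.pi fun i => Set.Ioo (-a i) (a i),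
      -x ∈ Set.univ.pi fun i => Set.Ioo (-a i) (a i) := by
    intro x hx i hi
    have := hx i hi
    exact ⟨by simpa using this.2, by simpa using neg_lt.1 this.1⟩
  have hlt : volume (ZSpan.fundamentalDomain b) * 2 ^ Module.finrank ℝ (Fin n → ℝ)
      < volume (Set.univ.pi fun i => Set.Ioo (-a i) (a i)) := by
    rw [hvol, ZSpan.volume_fundamentalDomain, Module.finrank_fin_fun]
    refine (ENNReal.mul_lt_mul_iff_left (by simp) (by simp)).2 ?_
    exact (ENNReal.ofReal_lt_ofReal_iff (by linarith)).2 hca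
  obtain ⟨w, hw0, hw⟩ := exists_ne_zero_mem_lattice_of_measure_mul_two_pow_lt_measure
    hF hsymm (convex_pi fun i _ => convex_Ioo _ _) hlt
  refine ⟨w, ?_, by simpa using hw0, fun i => abs_lt.2 (hw i trivial)⟩
  rw [hLs]
  exact w.2

/-- Linearly independent vectors of a unimodular lattice span a parallelepiped of volume at
least one. -/
lemma IsUnimodularLattice.one_le_abs_det {n : ℕ} {L : AddSubgroup (Fin n → ℝ)}
    (hL : IsUnimodularLattice L) {u : Fin n → Fin n → ℝ} (huL : ∀ i, u i ∈ L)
    (hu : LinearIndependent ℝ u) : 1 ≤ |(Matrix.of u).det| := by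
  obtain ⟨c, hc⟩ := hL.covolSpec_nonempty
  have hc1 := hL.one_le_of_covolSpec hc
  obtain ⟨b, hLb, rfl⟩ := covolSpec.exists_basis hL.1 hc
  have hA : ∀ i, ∃ A : Fin n → ℤ, ∑ j, A j • b j = u i := fun i => by
    rw [← Submodule.mem_span_range_iff_exists_fun, ← Submodule.mem_toAddSubgroup,
      Submodule.span_int_eq_addSubgroupClosure, ← hLb]
    exact huL i
  choose A hA using hA
  have hdet : (Matrix.of u).det = (((Matrix.of A).det : ℤ) : ℝ) * (Matrix.of ⇑b).det := by
    rw [← eq_intCast (Int.castRingHom ℝ), RingHom.map_det, ← Matrix.det_mul]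
    congr 1
    ext i k
    rw [Matrix.of_apply, ← hA i, Matrix.mul_apply]
    simp
  have hne : (Matrix.of u).det ≠ 0 := by
    have := (Matrix.linearIndependent_rows_iff_isUnit (A := Matrix.of u)).1 hu
    exact ((Matrix.isUnit_iff_isUnit_det _).1 this).ne_zero
  rw [hdet] at hne ⊢
  rw [abs_mul]
  have h1 : (1 : ℝ) ≤ |(((Matrix.of A).det : ℤ) : ℝ)| := by
    have : (Matrix.of A).det ≠ 0 := fun h => hne (by rw [h]; simp)
    exact_mod_cast Int.one_le_abs this
  nlinarith

lemma IsLattice.exists_le_abs {n : ℕ} {L : AddSubgroup (Fin n → ℝ)} (hL : IsLattice L) :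
    ∃ r > 0, ∀ w ∈ L, w ≠ 0 → ∃ i, r ≤ |w i| := by
  have := hL.1
  obtain ⟨r, hr, h⟩ := Metric.isOpen_iff.1 (isOpen_discrete {(0 : L)}) 0 rfl
  refine ⟨r, hr, fun w hw hw0 => ?_⟩
  by_contra! hcon
  have : (⟨w, hw⟩ : L) ∈ Metric.ball (0 : L) r := by
    rw [mem_ball_zero_iff]
    exact (pi_norm_lt_iff hr).2 hcon
  exact hw0 (congrArg Subtype.val (h this))

lemma IsLattice.finite_abs_le {n : ℕ} {L : AddSubgroup (Fin n → ℝ)} (hL : IsLattice L) (M : ℝ) :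
    {w | w ∈ L ∧ ∀ i, |w i| ≤ M}.Finite := by
  have := hL.1
  refine (Metric.finite_isBounded_inter_isClosed (s := (L : Set (Fin n → ℝ))) ⟨this⟩
    (Metric.isBounded_closedBall (x := 0) (r := |M|)) AddSubgroup.isClosed_of_discrete).subset ?_
  rintro w ⟨hw, h⟩
  refine ⟨?_, hw⟩
  rw [mem_closedBall_zero_iff, pi_norm_le_iff_of_nonneg (abs_nonneg M)]
  exact fun i => (h i).trans (le_abs_self M)

/-- **Hadamard's inequality** for matrices with bounded columns. -/
lemma abs_det_le {n : ℕ} {u : Fin n → Fin n → ℝ} {s : Fin n → ℝ}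
    (h : ∀ r i, |u r i| ≤ s i) : |(Matrix.of u).det| ≤ (n : ℝ) ^ ((n : ℝ) / 2) * ∏ i, s i := by
  have : Fact (Module.finrank ℝ (EuclideanSpace ℝ (Fin n)) = n) := ⟨by simp⟩
  let b := EuclideanSpace.basisFun (Fin n) ℝ
  have hvol := b.toBasis.orientation.abs_volumeForm_apply_le
    fun i => WithLp.toLp 2 fun r => u r i
  rw [b.toBasis.orientation.volumeForm_robust b rfl] at hvol
  have hdet : b.toBasis.det (fun i => WithLp.toLp 2 fun r => u r i) = (Matrix.of u).det := by
    rw [Module.Basis.det_apply]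
    congr 1
  rw [hdet] at hvol
  refine hvol.trans ?_
  have hle : ∀ i, ‖WithLp.toLp 2 fun r => u r i‖ ≤ Real.sqrt n * s i := by
    intro i
    have hs : 0 ≤ s i := (abs_nonneg _).trans (h i i)
    rw [EuclideanSpace.norm_eq, ← Real.sqrt_sq hs, ← Real.sqrt_mul (Nat.cast_nonneg n)]
    refine Real.sqrt_le_sqrt ?_
    calc ∑ r, ‖u r i‖ ^ 2 ≤ ∑ _r : Fin n, s i ^ 2 :=
          Finset.sum_le_sum fun r _ => pow_le_pow_left₀ (norm_nonneg _) (h r i) 2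
      _ = n * s i ^ 2 := by simp
  refine (Finset.prod_le_prod (fun i _ => norm_nonneg _) fun i _ => hle i).trans_eq ?_
  rw [Finset.prod_mul_distrib, Finset.prod_const, Finset.card_univ, Fintype.card_fin,
    Real.sqrt_eq_rpow, ← Real.rpow_natCast, ← Real.rpow_mul (Nat.cast_nonneg n)]
  congr 2
  ring

/-! ### Relevant lattice points -/

lemma exists_forall_notMem_span {V : Type*} [Finite V] {n : ℕ} (B : V → Fin n → ℝ) :
    ∃ β : Fin n → ℝ, (∀ i, 1 ≤ β i ∧ β i ≤ 2) ∧
      ∀ T : Finset V, T.card < n → β ∉ Submodule.span ℝ (B '' T) := by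
  have hnull : volume (⋃ T : {T : Finset V // T.card < n},
      (Submodule.span ℝ (B '' T.1) : Set (Fin n → ℝ))) = 0 := by
    rw [measure_iUnion_null_iff]
    rintro ⟨T, hT⟩
    refine Measure.addHaar_submodule _ _ fun h => ?_
    classical
    have hle := finrank_span_finset_le_card (R := ℝ) (T.image B)
    rw [Finset.coe_image, Set.finrank, h, finrank_top, Module.finrank_fin_fun] at hle
    exact absurd (hle.trans Finset.card_image_le) (not_le.2 hT)
  have hone : volume (Set.univ.pi fun _ : Fin n => Set.Icc (1 : ℝ) 2) = 1 := by
    rw [volume_pi_pi]; norm_num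
  obtain ⟨β, hβ, hβ'⟩ : ∃ β ∈ Set.univ.pi fun _ : Fin n => Set.Icc (1 : ℝ) 2,
      β ∉ ⋃ T : {T : Finset V // T.card < n},
        (Submodule.span ℝ (B '' T.1) : Set (Fin n → ℝ)) := by
    by_contra! h
    have := measure_mono (μ := volume) h
    rw [hone, hnull] at this
    exact absurd this (by simp)
  refine ⟨β, fun i => hβ i trivial, fun T hT h => hβ' ?_⟩
  exact Set.mem_iUnion.2 ⟨⟨T, hT⟩, h⟩

/-- The nonzero lattice points `v` bounded by `M` such that the open box with half-sides
`max |v i| δ` contains no nonzero lattice point. -/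
def relevant {n : ℕ} (L : AddSubgroup (Fin n → ℝ)) (M δ : ℝ) : Set (Fin n → ℝ) :=
  {v | v ∈ L ∧ v ≠ 0 ∧ (∀ i, |v i| ≤ M) ∧ ∀ w ∈ L, (∀ i, |w i| < max |v i| δ) → w = 0}

lemma IsLattice.finite_relevant {n : ℕ} {L : AddSubgroup (Fin n → ℝ)} (hL : IsLattice L)
    (M δ : ℝ) : (relevant L M δ).Finite :=
  (hL.finite_abs_le M).subset fun _ hv => ⟨hv.1, hv.2.2.1⟩

lemma IsLattice.exists_relevant {n : ℕ} {L : AddSubgroup (Fin n → ℝ)} (hL : IsLattice L)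
    {M δ r : ℝ} (hδr : δ < r) (hr : ∀ w ∈ L, w ≠ 0 → ∃ i, r ≤ |w i|)
    {s : Fin n → ℝ} (hδs : ∀ i, δ ≤ s i) (hsM : ∀ i, s i ≤ M)
    {w : Fin n → ℝ} (hw : w ∈ L) (hw0 : w ≠ 0) (hws : ∀ i, |w i| < s i) :
    ∃ v ∈ relevant L M δ, ∀ i, |v i| < s i := by
  have hfin : {v | v ∈ L ∧ v ≠ 0 ∧ ∀ i, |v i| < s i}.Finite :=
    (hL.finite_abs_le M).subset fun v hv => ⟨hv.1, fun i => (hv.2.2 i).le.trans (hsM i)⟩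
  obtain ⟨v, ⟨hv, hv0, hvs⟩, hmin⟩ := Set.exists_min_image _ (fun v => ‖v‖) hfin
    ⟨w, hw, hw0, hws⟩
  refine ⟨v, ⟨hv, hv0, fun i => (hvs i).le.trans (hsM i), fun u hu hlt => ?_⟩, hvs⟩
  by_contra hu0
  refine absurd (hmin u ⟨hu, hu0, fun i => (hlt i).trans_le (max_le (hvs i).le (hδs i))⟩)
    (not_le.2 ?_)
  obtain ⟨i, hi⟩ := hr v hv hv0
  rw [pi_norm_lt_iff (norm_pos_iff.2 hv0)]
  exact fun j => (hlt j).trans_le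
    (max_le (norm_le_pi_norm v j) ((hδr.le.trans hi).trans (norm_le_pi_norm v i)))

lemma abs_sub_lt_of_log_eq {k : ℕ} {a b : ℝ} (hs : 0 ≤ a ↔ 0 ≤ b)
    (h : Int.log 2 (max |a| ((2 : ℝ) ^ (-(k : ℤ) - 1)))
      = Int.log 2 (max |b| ((2 : ℝ) ^ (-(k : ℤ) - 1)))) :
    |a - b| < max |b| ((2 : ℝ) ^ (-(k : ℤ))) := by
  set d : ℝ := (2 : ℝ) ^ (-(k : ℤ) - 1) with hd
  have hd0 : 0 < d := by positivity
  have h2 : (2 : ℝ) ^ (-(k : ℤ)) = 2 * d := by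
    rw [hd, zpow_sub_one₀ two_ne_zero]; ring
  have ha := Int.lt_zpow_succ_log_self (b := 2) one_lt_two (max |a| d)
  have hb := Int.lt_zpow_succ_log_self (b := 2) one_lt_two (max |b| d)
  have ha' := Int.zpow_log_le_self (b := 2) one_lt_two (lt_max_of_lt_right hd0 : 0 < max |a| d)
  have hb' := Int.zpow_log_le_self (b := 2) one_lt_two (lt_max_of_lt_right hd0 : 0 < max |b| d)
  rw [h] at ha ha'
  set e := Int.log 2 (max |b| d)
  push_cast at ha ha' hb hb'
  rw [zpow_add_one₀ two_ne_zero] at ha hb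
  rw [h2]
  have haa := (max_lt_iff.1 ha).1
  have hbb := (max_lt_iff.1 hb).1
  have key : |a - b| < max |b| (2 * d) := by
    rcases lt_or_ge e (-(k : ℤ)) with he | he
    · have hle : (2 : ℝ) ^ e ≤ d := zpow_le_zpow_right₀ one_le_two (by omega)
      refine lt_max_of_lt_right ?_
      rcases le_or_gt 0 a with h0 | h0
      · have h0' := hs.1 h0
        rw [abs_of_nonneg h0] at haa
        rw [abs_of_nonneg h0'] at hbb
        rw [abs_lt]; constructor <;> linarith
      · have h0' : b < 0 := not_le.1 fun h => not_le.2 h0 (hs.2 h)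
        rw [abs_of_neg h0] at haa
        rw [abs_of_neg h0'] at hbb
        rw [abs_lt]; constructor <;> linarith
    · have hle : 2 * d ≤ (2 : ℝ) ^ e := h2 ▸ zpow_le_zpow_right₀ one_le_two he
      have hal : (2 : ℝ) ^ e ≤ |a| := (le_max_iff.1 ha').resolve_right (by linarith)
      have hbl : (2 : ℝ) ^ e ≤ |b| := (le_max_iff.1 hb').resolve_right (by linarith)
      refine lt_max_of_lt_left ?_
      rcases le_or_gt 0 a with h0 | h0
      · have h0' := hs.1 h0
        rw [abs_of_nonneg h0] at haa hal
        rw [abs_of_nonneg h0'] at hbb hbl ⊢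
        rw [abs_lt]; constructor <;> linarith
      · have h0' : b < 0 := not_le.1 fun h => not_le.2 h0 (hs.2 h)
        rw [abs_of_neg h0] at haa hal
        rw [abs_of_neg h0'] at hbb hbl ⊢
        rw [abs_lt]; constructor <;> linarith
  exact key

lemma card_le_of_subset_relevant {n k : ℕ} {L : AddSubgroup (Fin n → ℝ)}
    {S : Finset (Fin n → ℝ)} (hS : ∀ v ∈ S, v ∈ relevant L (2 ^ (n * k)) (2 ^ (-(k : ℤ)))) :
    S.card ≤ (2 * (n * k + k + 2)) ^ n := by
  classical
  let f : (Fin n → ℝ) → Fin n → Bool × ℤ := fun v i =>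
    (decide (0 ≤ v i), Int.log 2 (max |v i| ((2 : ℝ) ^ (-(k : ℤ) - 1))))
  have hmaps : ∀ v ∈ S, f v ∈ Fintype.piFinset fun _ : Fin n =>
      (Finset.univ : Finset Bool) ×ˢ Finset.Icc (-(k : ℤ) - 1) (n * k) := by
    intro v hv
    rw [Fintype.mem_piFinset]
    intro i
    have hpos : 0 < max |v i| ((2 : ℝ) ^ (-(k : ℤ) - 1)) := lt_max_of_lt_right (by positivity)
    refine Finset.mem_product.2 ⟨Finset.mem_univ _, Finset.mem_Icc.2 ⟨?_, ?_⟩⟩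
    · rw [← Int.zpow_le_iff_le_log one_lt_two hpos]
      exact_mod_cast le_max_right _ _
    · have hM : max |v i| ((2 : ℝ) ^ (-(k : ℤ) - 1)) ≤ (2 : ℝ) ^ ((n : ℤ) * k) := by
        refine max_le ?_ (zpow_le_zpow_right₀ one_le_two ?_)
        · exact_mod_cast (hS v hv).2.2.1 i
        · have : (0 : ℤ) ≤ n * k := by positivity
          omega
      refine (Int.log_mono_right hpos hM).trans_eq ?_
      exact_mod_cast Int.log_zpow (R := ℝ) one_lt_two ((n : ℤ) * k)
  have hinj : Set.InjOn f S := by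
    intro v hv w hw h
    have hvw := (hS w hw).2.2.2 (v - w) (sub_mem (hS v hv).1 (hS w hw).1) fun i => by
      have hi := congrFun h i
      exact abs_sub_lt_of_log_eq (decide_eq_decide.1 (congrArg Prod.fst hi)) (congrArg Prod.snd hi)
    exact sub_eq_zero.1 hvw
  refine (Finset.card_le_card_of_injOn f hmaps hinj).trans_eq ?_
  rw [Fintype.card_piFinset_const, Finset.card_product, Int.card_Icc, Finset.card_univ,
    Fintype.card_bool]
  congr 2
  have : (n : ℤ) * k + 1 - (-(k : ℤ) - 1) = ((n * k + k + 2 : ℕ) : ℤ) := by push_cast; ring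
  rw [this, Int.toNat_natCast]

/-- A vector `c` in the cube `[1, 2]ⁿ` whose inner products with finitely many given vectors are
not small. -/
lemma exists_forall_lt_abs_sum_mul {n : ℕ} (hn : 1 ≤ n) {S : Finset (Fin n → ℝ)} {r ε : ℝ}
    (hr : ∀ v ∈ S, ∃ i, r ≤ |v i|) (hr0 : 0 < r) (hε : 2 * ε * (S.card + 1) < r) :
    ∃ c : Fin n → ℝ, (∀ i, 1 ≤ c i ∧ c i ≤ 2) ∧ ∀ v ∈ S, ε < |∑ i, c i * v i| := by
  classical
  obtain ⟨m, rfl⟩ : ∃ m, n = m + 1 := ⟨n - 1, by omega⟩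
  set Q := S.card + 1 with hQ
  have hQ0 : (0 : ℝ) < Q := by positivity
  let c : (Fin (m + 1) → Fin Q) → Fin (m + 1) → ℝ := fun p i => 1 + (p i : ℕ) / Q
  have hc : ∀ p i, 1 ≤ c p i ∧ c p i ≤ 2 := fun p i => by
    have h1 : ((p i : ℕ) : ℝ) / Q ≤ 1 := by
      rw [div_le_one hQ0]; exact_mod_cast (p i).2.le
    have h0 : (0 : ℝ) ≤ ((p i : ℕ) : ℝ) / Q := by positivity
    constructor <;> simp only [c] <;> linarith
  by_contra! hcon
  let bad : (Fin (m + 1) → ℝ) → Finset (Fin (m + 1) → Fin Q) := fun v =>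
    Finset.univ.filter fun p => |∑ i, c p i * v i| ≤ ε
  have hbad : ∀ v ∈ S, (bad v).card ≤ Q ^ m := by
    intro v hv
    obtain ⟨i, hi⟩ := hr v hv
    have hinj : Set.InjOn (fun p : Fin (m + 1) → Fin Q => i.removeNth p) (bad v) := by
      intro p hp q hq hpq
      have hoff : ∀ j, p (i.succAbove j) = q (i.succAbove j) := fun j => congrFun hpq j
      have hp' : |∑ i, c p i * v i| ≤ ε := (Finset.mem_filter.1 hp).2
      have hq' : |∑ i, c q i * v i| ≤ ε := (Finset.mem_filter.1 hq).2
      have hdiff : ∑ i, c p i * v i - ∑ i, c q i * v i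
          = (((p i : ℕ) : ℤ) - ((q i : ℕ) : ℤ) : ℤ) / Q * v i := by
        rw [Fin.sum_univ_succAbove _ i, Fin.sum_univ_succAbove _ i]
        simp only [c, hoff]
        push_cast
        ring
      have hle : |(((p i : ℕ) : ℤ) - ((q i : ℕ) : ℤ) : ℤ) / (Q : ℝ) * v i| ≤ 2 * ε := by
        rw [← hdiff]
        exact (abs_sub _ _).trans (by linarith)
      have hpi : p i = q i := by
        by_contra hne
        have h1 : (1 : ℝ) ≤ |((((p i : ℕ) : ℤ) - ((q i : ℕ) : ℤ) : ℤ) : ℝ)| := by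
          have : ((p i : ℕ) : ℤ) - ((q i : ℕ) : ℤ) ≠ 0 := fun h => hne (Fin.ext (by omega))
          exact_mod_cast Int.one_le_abs this
        rw [abs_mul, abs_div, abs_of_pos hQ0, div_mul_eq_mul_div, div_le_iff₀ hQ0] at hle
        have h2 := mul_le_mul h1 hi hr0.le (abs_nonneg _)
        have h3 : 2 * ε * Q < r := by rw [hQ]; push_cast; exact hε
        linarith
      funext j
      rcases Fin.eq_self_or_eq_succAbove i j with rfl | ⟨l, rfl⟩
      · exact hpi
      · exact hoff l
    have := Finset.card_le_card_of_injOn (t := Finset.univ) _ (fun _ _ => Finset.mem_univ _) hinj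
    simpa using this
  have hcover : (Finset.univ : Finset (Fin (m + 1) → Fin Q)) ⊆ S.biUnion bad := by
    intro p _
    obtain ⟨v, hv, hle⟩ := hcon (c p) (hc p)
    exact Finset.mem_biUnion.2 ⟨v, hv, Finset.mem_filter.2 ⟨Finset.mem_univ _, hle⟩⟩
  have h1 := (Finset.card_le_card hcover).trans (Finset.card_biUnion_le_card_mul _ _ _ hbad)
  rw [Finset.card_univ, Fintype.card_fun, Fintype.card_fin, Fintype.card_fin, pow_succ,
    mul_comm] at h1
  have := Nat.le_of_mul_le_mul_right h1 (by positivity)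
  omega

lemma exists_pow_lt (n : ℕ) {r : ℝ} (hr : 0 < r) :
    ∃ k : ℕ, 1 ≤ k ∧
      16 * n * (2 : ℝ) ^ (-(k : ℤ)) * (((2 * (n * k + k + 2)) ^ n : ℕ) + 1) < r := by
  have ht := (tendsto_pow_const_div_const_pow_of_one_lt n (one_lt_two : (1 : ℝ) < 2)).const_mul
    (16 * n * (2 * (2 * n + 6) ^ n) : ℝ)
  rw [mul_zero] at ht
  obtain ⟨k, hk, hk1⟩ := ((ht.eventually_lt_const hr).and (eventually_ge_atTop 1)).exists
  refine ⟨k, hk1, lt_of_le_of_lt ?_ hk⟩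
  have h1 : (1 : ℝ) ≤ k := by exact_mod_cast hk1
  have h2 : ((2 * (n * k + k + 2)) ^ n : ℕ) + (1 : ℝ) ≤ 2 * ((2 * n + 6) ^ n * (k : ℝ) ^ n) := by
    have h3 : (2 * (n * k + k + 2) : ℝ) ≤ (2 * n + 6) * k := by nlinarith
    have h4 : (2 * (n * k + k + 2) : ℝ) ^ n ≤ ((2 * n + 6) * k) ^ n :=
      pow_le_pow_left₀ (by positivity) h3 n
    have h5 : (1 : ℝ) ≤ ((2 * n + 6) * k) ^ n := by
      refine one_le_pow₀ ?_
      have : (0 : ℝ) ≤ n := by positivity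
      nlinarith
    rw [← mul_pow]
    push_cast
    linarith
  rw [_root_.zpow_neg, zpow_natCast]
  calc _ ≤ 16 * n * ((2 : ℝ) ^ k)⁻¹ * (2 * ((2 * n + 6) ^ n * (k : ℝ) ^ n)) := by gcongr
    _ = _ := by rw [div_eq_mul_inv]; ring

/-! ### Large admissible boxes -/

/-- If some linear functional `c` is not small on the relevant points, then the coordinatewise
maxima over a suitable set of relevant points form a large admissible box. -/
lemma IsUnimodularLattice.exists_isAdmissibleBox_of_functional {n : ℕ} (hn : 2 ≤ n)
    {L : AddSubgroup (Fin n → ℝ)} (hL : IsUnimodularLattice L) {M δ r : ℝ} (hδ : 0 < δ)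
    (hδM : δ ≤ M) (hMδ : 1 < M * δ ^ (n - 1)) (hδr : δ < r)
    (hr : ∀ w ∈ L, w ≠ 0 → ∃ i, r ≤ |w i|) {c : Fin n → ℝ} (hc : ∀ i, 1 ≤ c i ∧ c i ≤ 2)
    (hcR : ∀ v ∈ relevant L M δ, 8 * n * δ < |∑ i, c i * v i|) :
    ∃ a, IsAdmissibleBox L a ∧ 1 ≤ (n : ℝ) ^ ((n : ℝ) / 2) * ∏ i, a i := by
  classical
  have hM : 0 < M := hδ.trans_le hδM
  have hn0 : (0 : ℝ) < n := by positivity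
  have hfin := hL.1.finite_relevant M δ
  have : Fintype (relevant L M δ) := hfin.fintype
  let ℓ : (Fin n → ℝ) →ₗ[ℝ] ℝ := ∑ i, c i • LinearMap.proj i
  have hℓ : ∀ w, ℓ w = ∑ i, c i * w i := fun w => by simp [ℓ]
  have hsign : ∀ v : relevant L M δ, ∃ u : Fin n → ℝ,
      u ∈ L ∧ 8 * n * δ < ℓ u ∧ ∀ i, |u i| = |v.1 i| := by
    intro v
    have h := hcR v v.2
    rw [← hℓ] at h
    rcases abs_choice (ℓ v) with h' | h'
    · exact ⟨v, v.2.1, h' ▸ h, fun _ => rfl⟩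
    · exact ⟨-v, neg_mem v.2.1, by rw [map_neg, ← h']; exact h, fun i => by simp⟩
  choose u huL huℓ hu using hsign
  let B : Fin n ⊕ relevant L M δ → Fin n → ℝ := Sum.elim (fun i => Pi.single i 1) u
  let g : Fin n → Fin n ⊕ relevant L M δ → ℝ := fun i =>
    Sum.elim (fun j => if j = i then M + 1 else -1) fun v => |v.1 i|
  have hgM : ∀ i v, g i (Sum.inr v) ≤ M := fun i v => v.2.2.2.1 i
  have hBℓ : ∀ v, 0 < ℓ (B v) := by
    rintro (i | v)
    · simp only [hℓ, B, Sum.elim_inl, Pi.single_apply]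
      simp
      linarith [(hc i).1]
    · exact lt_trans (by positivity) (huℓ v)
  obtain ⟨β, hβ, hgen⟩ := exists_forall_notMem_span B
  obtain ⟨S, hSn, hdom, x, hx0, hx⟩ := exists_dominating_inCone_real hn (g := g)
    (σ := Sum.inl) (B := B) (β := β)
    (by
      rintro i (j | v) hv
      · have : j ≠ i := fun h => hv (by rw [h])
        simp only [g, Sum.elim_inl, if_neg this, if_true]
        linarith
      · have := hgM i v
        simp only [g, Sum.elim_inl, if_true] at this ⊢
        linarith)
    (by
      rintro i j (l | v) hj hv
      · exact absurd ⟨l, rfl⟩ hv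
      · simp only [g, Sum.elim_inl, Sum.elim_inr, if_neg hj]
        linarith [abs_nonneg (v.1 i)])
    Sum.inl_injective hgen ℓ hBℓ
    ⟨β, fun i => by linarith [(hβ i).1], by
      ext j
      simp [B, Finset.sum_apply, Pi.single_apply]⟩
  have hlarge : ∀ j, ∃ v ∈ S, δ < g j v := by
    intro j
    by_contra! h
    have hBj : ∀ v ∈ S, B v j ≤ ℓ (B v) / (8 * n) := by
      rintro (i | v) hv
      · have hij : j ≠ i := by
          rintro rfl
          have := h _ hv
          simp only [g, Sum.elim_inl, if_true] at this
          linarith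
        have h0 : B (Sum.inl i) j = 0 := by simp [B, hij]
        rw [h0]
        have := hBℓ (Sum.inl i)
        positivity
      · have h1 : |v.1 j| ≤ δ := h _ hv
        rw [le_div_iff₀ (by positivity)]
        have h2 : u v j ≤ δ := (le_abs_self _).trans ((hu v j).trans_le h1)
        have h3 := huℓ v
        change u v j * (8 * n) ≤ ℓ (u v)
        nlinarith
    have hβj : β j ≤ ℓ β / (8 * n) := by
      rw [← hx, Finset.sum_apply, map_sum, Finset.sum_div]
      refine Finset.sum_le_sum fun v hv => ?_
      rw [map_smul, Pi.smul_apply, smul_eq_mul, smul_eq_mul, mul_div_assoc]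
      exact mul_le_mul_of_nonneg_left (hBj v hv) (hx0 v hv)
    have hℓβ : ℓ β ≤ 4 * n := by
      rw [hℓ]
      calc ∑ i, c i * β i ≤ ∑ _i : Fin n, (4 : ℝ) := Finset.sum_le_sum fun i _ => by
            nlinarith [hc i, hβ i]
        _ = 4 * n := by simp [mul_comm]
    rw [le_div_iff₀ (by positivity)] at hβj
    nlinarith [(hβ j).1]
  have hdomR : ∀ w ∈ relevant L M δ, ∃ i, ∀ s ∈ S, g i s ≤ |w i| := fun w hw =>
    hdom (Sum.inr ⟨w, hw⟩)
  have hreal : ∀ i, Sum.inl i ∉ S := by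
    intro i hi
    let s : Fin n → ℝ := fun j => if j = i then M else δ
    have hs0 : ∀ j, δ ≤ s j ∧ s j ≤ M := fun j => by
      by_cases h : j = i <;> simp [s, h, hδM]
    have hprod : ∏ j, s j = M * δ ^ (n - 1) := by
      rw [← Finset.mul_prod_erase _ _ (Finset.mem_univ i)]
      congr 1
      · simp [s]
      · rw [Finset.prod_congr rfl fun j hj => if_neg (Finset.ne_of_mem_erase hj)]
        simp
    obtain ⟨w, hw, hw0, hws⟩ := hL.exists_abs_lt (fun j => hδ.trans_le (hs0 j).1)
      (hMδ.trans_eq hprod.symm)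
    obtain ⟨v, hv, hvs⟩ := hL.1.exists_relevant hδr hr (fun j => (hs0 j).1) (fun j => (hs0 j).2)
      hw hw0 hws
    obtain ⟨j, hj⟩ := hdomR v hv
    by_cases hji : j = i
    · have h1 := hj _ hi
      have h2 := hv.2.2.1 j
      simp only [g, hji, Sum.elim_inl, if_true] at h1 h2
      linarith
    · obtain ⟨t, ht, htδ⟩ := hlarge j
      have h1 := htδ.trans_le (hj t ht)
      have h2 := hvs j
      simp only [s, if_neg hji] at h2
      linarith
  have hSne : S.Nonempty := Finset.card_pos.1 (by omega)
  choose m hmS hmax using fun i => Finset.exists_max_image S (g i) hSne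
  have hmδ : ∀ i, δ < g i (m i) := fun i => by
    obtain ⟨t, ht, htδ⟩ := hlarge i
    exact htδ.trans_le (hmax i t ht)
  have hmM : ∀ i, g i (m i) ≤ M := fun i => by
    rcases h : m i with j | v
    · exact absurd (h ▸ hmS i) (hreal j)
    · exact hgM i v
  refine ⟨fun i => g i (m i), ⟨fun i => hδ.trans (hmδ i), fun w hw hw0 => ?_⟩, ?_⟩
  · by_contra! hcon
    obtain ⟨v, hv, hvs⟩ := hL.1.exists_relevant hδr hr (fun i => (hmδ i).le) hmM hw hw0 hcon
    obtain ⟨i, hi⟩ := hdomR v hv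
    exact absurd (hi _ (hmS i)) (not_le.2 (hvs i))
  · have hli := linearIndepOn_of_generic hgen hSn.le hx
    let e : Fin n ≃ S := (S.equivFinOfCardEq hSn).symm
    have hmem : ∀ t ∈ S, B t ∈ L ∧ ∀ i, |B t i| = g i t := by
      rintro (j | v) ht
      · exact absurd ht (hreal j)
      · exact ⟨huL v, hu v⟩
    refine (hL.one_le_abs_det (u := fun i => B (e i)) (fun i => (hmem _ (e i).2).1)
      (LinearIndependent.comp hli e e.injective)).trans (abs_det_le fun i j => ?_)
    rw [(hmem _ (e i).2).2 j]
    exact hmax j _ (e i).2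

lemma IsUnimodularLattice.exists_isAdmissibleBox {n : ℕ} (hn : 2 ≤ n)
    {L : AddSubgroup (Fin n → ℝ)} (hL : IsUnimodularLattice L) :
    ∃ a, IsAdmissibleBox L a ∧ 1 ≤ (n : ℝ) ^ ((n : ℝ) / 2) * ∏ i, a i := by
  obtain ⟨r, hr0, hr⟩ := hL.1.exists_le_abs
  obtain ⟨k, hk1, hk⟩ := exists_pow_lt n hr0
  set δ : ℝ := 2 ^ (-(k : ℤ)) with hδ
  have hδ0 : 0 < δ := by positivity
  have hδk : δ * 2 ^ k = 1 := by
    rw [hδ, _root_.zpow_neg, zpow_natCast, inv_mul_cancel₀ (by positivity)]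
  have hn' : (2 : ℝ) ≤ n := by exact_mod_cast hn
  have hfin := hL.1.finite_relevant (2 ^ (n * k)) δ
  have hcard : (hfin.toFinset.card : ℝ) ≤ ((2 * (n * k + k + 2)) ^ n : ℕ) := by
    exact_mod_cast card_le_of_subset_relevant fun v hv => hfin.mem_toFinset.1 hv
  have hδr : δ < r := by
    refine lt_of_le_of_lt ?_ hk
    have h1 : (0 : ℝ) ≤ ((2 * (n * k + k + 2)) ^ n : ℕ) := Nat.cast_nonneg _
    nlinarith [mul_nonneg (mul_nonneg (Nat.cast_nonneg (α := ℝ) n) hδ0.le) h1]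
  obtain ⟨c, hc, hcS⟩ := exists_forall_lt_abs_sum_mul (by omega : 1 ≤ n) (S := hfin.toFinset)
    (r := r) (ε := 8 * n * δ)
    (fun v hv => hr v (hfin.mem_toFinset.1 hv).1 (hfin.mem_toFinset.1 hv).2.1) hr0 (by
      refine lt_of_le_of_lt ?_ hk
      calc _ = 16 * n * δ * ((hfin.toFinset.card : ℝ) + 1) := by ring
        _ ≤ _ := by gcongr)
  refine hL.exists_isAdmissibleBox_of_functional hn hδ0 ?_ ?_ hδr hr hc
    fun v hv => hcS v (hfin.mem_toFinset.2 hv)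
  · rw [hδ, ← zpow_natCast]
    exact zpow_le_zpow_right₀ one_le_two (by push_cast; nlinarith)
  · have : (2 : ℝ) ^ (n * k) = 2 ^ k * (2 ^ k) ^ (n - 1) := by
      rw [← pow_succ', ← pow_mul, mul_comm k]
      congr 2
      omega
    rw [this, mul_assoc, ← mul_pow, mul_comm _ δ, hδk, one_pow, mul_one]
    exact one_lt_pow₀ one_lt_two (by omega)

/-- Admissible boxes have bounded volume, by Minkowski's theorem. -/
lemma IsUnimodularLattice.prod_le_one {n : ℕ} {L : AddSubgroup (Fin n → ℝ)}
    (hL : IsUnimodularLattice L) {a : Fin n → ℝ} (ha : IsAdmissibleBox L a) : ∏ i, a i ≤ 1 := by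
  by_contra! h
  obtain ⟨w, hw, hw0, hlt⟩ := hL.exists_abs_lt ha.1 h
  obtain ⟨i, hi⟩ := ha.2 w hw hw0
  exact absurd (hlt i) (not_lt.2 hi)

end SW


/-- **Corollary 1.2.** For all `n ≥ 2`, the Mordell constant satisfies `κ_n ≥ n^{-n/2}`,
i.e. `κ(x) ≥ n^{-n/2}` for every unimodular lattice `x` in `ℝⁿ`. -/
theorem SW.mordell_const_lower_bound (n : ℕ) (hn : 2 ≤ n)
    (L : AddSubgroup (Fin n → ℝ)) (hL : SW.IsUnimodularLattice L) :
    (n : ℝ) ^ (-(n : ℝ) / 2) ≤ SW.mordellConst L := by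
  obtain ⟨a, ha, h1⟩ := hL.exists_isAdmissibleBox hn
  have hvol : ∀ a : Fin n → ℝ, ∏ i, 2 * a i = 2 ^ n * ∏ i, a i := fun a => by
    simp [Finset.prod_mul_distrib]
  have hbdd : BddAbove {V | ∃ a : Fin n → ℝ, SW.IsAdmissibleBox L a ∧ V = ∏ i, 2 * a i} := by
    refine ⟨2 ^ n, ?_⟩
    rintro _ ⟨a, ha, rfl⟩
    rw [hvol]
    exact mul_le_of_le_one_right (by positivity) (hL.prod_le_one ha)
  have hle := le_csSup hbdd ⟨a, ha, rfl⟩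
  have hn0 : (0 : ℝ) < n := by positivity
  calc (n : ℝ) ^ (-(n : ℝ) / 2) ≤ ∏ i, a i := by
        rw [neg_div, Real.rpow_neg hn0.le]
        exact (inv_le_iff_one_le_mul₀' (Real.rpow_pos_of_pos hn0 _)).2 h1
    _ = 1 / 2 ^ n * ∏ i, 2 * a i := by rw [hvol]; field_simp
    _ ≤ SW.mordellConst L := mul_le_mul_of_nonneg_left hle (by positivity)
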